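/- Fix γ > 0, T > 0, and bounds μ, ρ, ν > 0. There exists C ≥ 1, depending only on γ, T, μ, ρ, ν (and independent of ε), such that the following holds for every ε > 0: if ξ, η : [0,T] × ℝ → ℝ are continuous in t and smooth mean-zero 2π-periodic in x with sup_{0≤t≤T} ‖ξ(t,·)‖_{H²} ≤ ρ and sup_{0≤t≤T} ‖η(t,·)‖_{L²} ≤ ν, and v is a smooth solution on [0,T] of the regularized equation ∂_t v + γ v + ∂_x³ v + ∂_x(ξ v) + v ∂_x v + ε ∂_x⁴ v = η with ‖v(0,·)‖_{L²} ≤ μ, then sup_{0≤t≤T} ‖v(t,·)‖_{L²} + ε^{1/2} ( ∫₀^T ‖v(t,·)‖_{H²}² dt )^{1/2} ≤ C. -/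

import Mathlib

open MeasureTheory Real Filter Topology

noncomputable section

/-- A smooth, mean-zero, `2π`-periodic function `v : ℝ → ℝ`. -/
def SmoothMeanZeroPeriodic (v : ℝ → ℝ) : Prop :=
  ContDiff ℝ (⊤ : ℕ∞) v ∧ (∀ x : ℝ, v (x + 2 * Real.pi) = v x) ∧
    (∫ x in (0:ℝ)..(2 * Real.pi), v x) = 0

/-- The `L²` norm over one period: `(∫₀^{2π} |v|²)^{1/2}`. -/
def L2norm (v : ℝ → ℝ) : ℝ := Real.sqrt (∫ x in (0:ℝ)..(2 * Real.pi), (v x) ^ 2)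

/-- The homogeneous Sobolev norm `‖v‖_{H^m} = ‖D^m v‖_{L²}`. -/
def Hnorm (m : ℕ) (v : ℝ → ℝ) : ℝ := L2norm (iteratedDeriv m v)

/-- Time-dependent data on `[0,T]`: continuous in `t`, smooth mean-zero `2π`-periodic
in `x`, with `H^k` norm bounded by `ρ` for each `t ∈ [0,T]`. -/
def RegData (T : ℝ) (k : ℕ) (ρ : ℝ) (ξ : ℝ → ℝ → ℝ) : Prop :=
  (∀ x : ℝ, Continuous fun t => ξ t x) ∧
  (∀ t : ℝ, 0 ≤ t → t ≤ T → SmoothMeanZeroPeriodic (ξ t)) ∧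
  (∀ t : ℝ, 0 ≤ t → t ≤ T → Hnorm k (ξ t) ≤ ρ)

/-- A smooth solution on `[0,T]` of the regularized equation
`∂ₜv + γv + ∂ₓ³v + ∂ₓ(ξ v) + v ∂ₓv + ε ∂ₓ⁴v = η`,
mean-zero `2π`-periodic in `x`. -/
def IsRegSol (γ ε T : ℝ) (ξ η v : ℝ → ℝ → ℝ) : Prop :=
  ContDiff ℝ (⊤ : ℕ∞) (fun p : ℝ × ℝ => v p.1 p.2) ∧
  (∀ t : ℝ, 0 ≤ t → t ≤ T → SmoothMeanZeroPeriodic (v t)) ∧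
  (∀ t x : ℝ, 0 ≤ t → t ≤ T →
    deriv (fun s => v s x) t + γ * v t x + iteratedDeriv 3 (v t) x
      + deriv (fun y => ξ t y * v t y) x + v t x * deriv (v t) x
      + ε * iteratedDeriv 4 (v t) x = η t x)

open intervalIntegral in
/-- Differentiation under the integral sign for a continuously differentiable integrand. -/
theorem hasDerivAt_intervalIntegral_of_continuous {F F' : ℝ → ℝ → ℝ} (a b t : ℝ)
    (hF : ∀ s, Continuous (F s)) (hF' : Continuous (Function.uncurry F'))
    (hd : ∀ s x, HasDerivAt (fun r => F r x) (F' s x) s) :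
    HasDerivAt (fun s => ∫ x in a..b, F s x) (∫ x in a..b, F' t x) t := by
  have hK : IsCompact (Metric.closedBall t 1 ×ˢ Set.uIcc a b) :=
    (isCompact_closedBall t 1).prod isCompact_uIcc
  obtain ⟨M, hM⟩ := hK.exists_bound_of_continuousOn hF'.continuousOn
  refine (hasDerivAt_integral_of_dominated_loc_of_deriv_le (bound := fun _ => M)
    (Metric.closedBall_mem_nhds t one_pos)
    (Eventually.of_forall fun s => (hF s).aestronglyMeasurable)
    ((hF t).intervalIntegrable a b)
    (hF'.comp (Continuous.prodMk_right t)).aestronglyMeasurable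
    (Eventually.of_forall fun x hx s hs => ?_) (by simp)
    (Eventually.of_forall fun x _ s _ => hd s x)).2
  exact hM (s, x) ⟨hs, Set.uIoc_subset_uIcc hx⟩

theorem ContDiff.iteratedDeriv_infty {u : ℝ → ℝ} (hu : ContDiff ℝ (⊤ : ℕ∞) u) (k : ℕ) :
    ContDiff ℝ (⊤ : ℕ∞) (iteratedDeriv k u) := by
  induction k with
  | zero => simpa using hu
  | succ k ih =>
    rw [iteratedDeriv_succ]
    exact (contDiff_infty_iff_deriv.1 ih).2

theorem ContDiff.hasDerivAt_iteratedDeriv {u : ℝ → ℝ} (hu : ContDiff ℝ (⊤ : ℕ∞) u) (k : ℕ)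
    (x : ℝ) : HasDerivAt (iteratedDeriv k u) (iteratedDeriv (k + 1) u x) x := by
  rw [iteratedDeriv_succ]
  exact ((contDiff_infty_iff_deriv.1 (hu.iteratedDeriv_infty k)).1 x).hasDerivAt

theorem iteratedDeriv_add_period {u : ℝ → ℝ} {L : ℝ} (hu : ∀ x, u (x + L) = u x) (k : ℕ) (x : ℝ) :
    iteratedDeriv k u (x + L) = iteratedDeriv k u x := by
  have h := congrFun (iteratedDeriv_comp_add_const k u L) x
  rwa [funext hu, eq_comm] at h

/-- The spatial derivative of a jointly smooth function is jointly smooth. -/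
theorem contDiff_iteratedDeriv_snd {v : ℝ → ℝ → ℝ}
    (hv : ContDiff ℝ (⊤ : ℕ∞) (Function.uncurry v)) (k : ℕ) :
    ContDiff ℝ (⊤ : ℕ∞) (fun p : ℝ × ℝ => iteratedDeriv k (v p.1) p.2) := by
  induction k with
  | zero => simpa [Function.uncurry_def] using hv
  | succ k ih =>
    have hfd : ContDiff ℝ (⊤ : ℕ∞) (fun p => fderiv ℝ
        (fun p : ℝ × ℝ => iteratedDeriv k (v p.1) p.2) p ((0 : ℝ), (1 : ℝ))) :=
      (ih.fderiv_right (by simp)).clm_apply contDiff_const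
    convert hfd using 2 with p
    rw [iteratedDeriv_succ]
    have h1 := (ih.differentiable (by simp) p).hasFDerivAt
    have h2 : HasDerivAt (fun y : ℝ => (p.1, y)) ((0 : ℝ), (1 : ℝ)) p.2 :=
      (hasDerivAt_const _ _).prodMk (hasDerivAt_id _)
    exact (HasFDerivAt.comp_hasDerivAt (x := p.2) (f := fun y : ℝ => (p.1, y)) h1 h2).deriv

/-- The time derivative of a jointly smooth function is jointly smooth. -/
theorem contDiff_deriv_fst {v : ℝ → ℝ → ℝ} (hv : ContDiff ℝ (⊤ : ℕ∞) (Function.uncurry v)) :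
    ContDiff ℝ (⊤ : ℕ∞) (fun p : ℝ × ℝ => deriv (fun s => v s p.2) p.1) := by
  have hfd : ContDiff ℝ (⊤ : ℕ∞) (fun p => fderiv ℝ (Function.uncurry v) p ((1 : ℝ), (0 : ℝ))) :=
    (hv.fderiv_right (by simp)).clm_apply contDiff_const
  convert hfd using 2 with p
  have h1 := (hv.differentiable (by simp) p).hasFDerivAt
  have h2 : HasDerivAt (fun s : ℝ => (s, p.2)) ((1 : ℝ), (0 : ℝ)) p.1 :=
    (hasDerivAt_id _).prodMk (hasDerivAt_const _ _)
  exact (HasFDerivAt.comp_hasDerivAt (x := p.1) (f := fun s : ℝ => (s, p.2)) h1 h2).deriv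

/-- The derivative of a periodic function is bounded by the `L²` norm of the second derivative. -/
theorem abs_deriv_le_of_periodic {w : ℝ → ℝ} {L x : ℝ} (hL : 0 < L)
    (hw : ContDiff ℝ (⊤ : ℕ∞) w) (hper : ∀ x, w (x + L) = w x) (hx : x ∈ Set.Icc 0 L) :
    |deriv w x| ≤ (L + ∫ y in (0 : ℝ)..L, (iteratedDeriv 2 w y) ^ 2) / 2 := by
  obtain ⟨c, hc, hc0⟩ := exists_deriv_eq_zero hL hw.continuous.continuousOn
    (by simpa using (hper 0).symm)
  have h2c : Continuous (iteratedDeriv 2 w) := (hw.iteratedDeriv_infty 2).continuous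
  have hftc : ∫ y in c..x, iteratedDeriv 2 w y = deriv w x := by
    have h := intervalIntegral.integral_eq_sub_of_hasDerivAt
      (fun y (_ : y ∈ Set.uIcc c x) => hw.hasDerivAt_iteratedDeriv 1 y)
      (h2c.intervalIntegrable c x)
    simpa [iteratedDeriv_one, hc0] using h
  have hcont : Continuous fun y => (1 + (iteratedDeriv 2 w y) ^ 2) / 2 := by fun_prop
  have hsub : Set.uIoc c x ⊆ Set.uIoc 0 L := by
    rw [Set.uIoc_of_le hL.le]
    exact Set.Ioc_subset_Ioc (le_min hc.1.le hx.1) (max_le hc.2.le hx.2)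
  have hnn : 0 ≤ ∫ y in (0 : ℝ)..L, (1 + (iteratedDeriv 2 w y) ^ 2) / 2 :=
    intervalIntegral.integral_nonneg hL.le fun y _ => by positivity
  calc |deriv w x| = ‖∫ y in c..x, iteratedDeriv 2 w y‖ := by rw [hftc, Real.norm_eq_abs]
    _ ≤ |∫ y in c..x, (1 + (iteratedDeriv 2 w y) ^ 2) / 2| := by
        refine intervalIntegral.norm_integral_le_abs_of_norm_le
          (Eventually.of_forall fun y => ?_) (hcont.intervalIntegrable _ _)
        rw [Real.norm_eq_abs]
        nlinarith [sq_nonneg (|iteratedDeriv 2 w y| - 1), sq_abs (iteratedDeriv 2 w y)]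
    _ ≤ |∫ y in (0 : ℝ)..L, (1 + (iteratedDeriv 2 w y) ^ 2) / 2| :=
        intervalIntegral.abs_integral_mono_interval hsub
          (Eventually.of_forall fun y => by simp only [Pi.zero_apply]; positivity)
          (hcont.intervalIntegrable _ _)
    _ = (L + ∫ y in (0 : ℝ)..L, (iteratedDeriv 2 w y) ^ 2) / 2 := by
        rw [abs_of_nonneg hnn, intervalIntegral.integral_div, intervalIntegral.integral_add
          (by simp) (Continuous.intervalIntegrable (by fun_prop) _ _)]
        simp

/-- The energy inequality at a fixed time, obtained by testing the equation against `u`. -/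
theorem integral_mul_le_of_regularized {L γ ε B : ℝ} {u ξ η w : ℝ → ℝ} (hL : 0 ≤ L) (hγ : 0 ≤ γ)
    (hu : ContDiff ℝ (⊤ : ℕ∞) u) (huper : ∀ x, u (x + L) = u x)
    (hξ : ContDiff ℝ (⊤ : ℕ∞) ξ) (hξper : ∀ x, ξ (x + L) = ξ x)
    (hη : Continuous η) (hw : Continuous w)
    (hB : ∀ x ∈ Set.Icc 0 L, |deriv ξ x| ≤ B)
    (heq : ∀ x, w x + γ * u x + iteratedDeriv 3 u x + deriv (fun y => ξ y * u y) x
      + u x * deriv u x + ε * iteratedDeriv 4 u x = η x) :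
    ∫ x in (0 : ℝ)..L, 2 * u x * w x ≤
      (B + 1) * (∫ x in (0 : ℝ)..L, u x ^ 2) + (∫ x in (0 : ℝ)..L, η x ^ 2)
        - 2 * ε * ∫ x in (0 : ℝ)..L, iteratedDeriv 2 u x ^ 2 := by
  have hc (k : ℕ) : Continuous (iteratedDeriv k u) := (hu.iteratedDeriv_infty k).continuous
  have hcu := hu.continuous
  have hcξ := hξ.continuous
  have hcξ' := (contDiff_infty_iff_deriv.1 hξ).2.continuous
  let P : ℝ → ℝ := fun x => 2 * (u x * iteratedDeriv 2 u x) - iteratedDeriv 1 u x ^ 2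
    + ξ x * u x ^ 2 + 2 / 3 * u x ^ 3
    + 2 * ε * (u x * iteratedDeriv 3 u x - iteratedDeriv 1 u x * iteratedDeriv 2 u x)
  let P' : ℝ → ℝ := fun x => 2 * (u x * iteratedDeriv 3 u x)
    + (deriv ξ x * u x ^ 2 + 2 * ξ x * u x * iteratedDeriv 1 u x)
    + 2 * u x ^ 2 * iteratedDeriv 1 u x
    + 2 * ε * (u x * iteratedDeriv 4 u x - iteratedDeriv 2 u x ^ 2)
  have hu0 (x : ℝ) : HasDerivAt u (iteratedDeriv 1 u x) x := by
    simpa using hu.hasDerivAt_iteratedDeriv 0 x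
  have hξ0 (x : ℝ) : HasDerivAt ξ (deriv ξ x) x := ((contDiff_infty_iff_deriv.1 hξ).1 x).hasDerivAt
  have hP (x : ℝ) : HasDerivAt P (P' x) x := by
    have h1 := hu.hasDerivAt_iteratedDeriv 1 x
    have h2 := hu.hasDerivAt_iteratedDeriv 2 x
    have h3 := hu.hasDerivAt_iteratedDeriv 3 x
    have h := ((((((hu0 x).mul h2).const_mul 2).sub (h1.pow 2)).add
      ((hξ0 x).mul ((hu0 x).pow 2))).add (((hu0 x).pow 3).const_mul (2 / 3))).add
      ((((hu0 x).mul h3).sub (h1.mul h2)).const_mul (2 * ε))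
    refine h.congr_deriv ?_
    simp only [P', Pi.pow_apply]
    norm_num
    ring
  have hP'c : Continuous P' := by
    have := hc 1; have := hc 2; have := hc 3; have := hc 4
    fun_prop
  have hP0 : ∫ x in (0 : ℝ)..L, P' x = 0 := by
    rw [intervalIntegral.integral_eq_sub_of_hasDerivAt (fun x _ => hP x)
      (hP'c.intervalIntegrable _ _)]
    have hk (k : ℕ) := iteratedDeriv_add_period huper k 0
    have h0 := huper 0
    have h0' := hξper 0
    simp only [zero_add] at hk h0 h0'
    simp only [P, hk, h0, h0', sub_self]
  have hint {f : ℝ → ℝ} (hf : Continuous f) : IntervalIntegrable f volume 0 L :=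
    hf.intervalIntegrable _ _
  have hc2 := hc 2
  have key : ∫ x in (0 : ℝ)..L, 2 * u x * w x ≤ ∫ x in (0 : ℝ)..L,
      ((B + 1) * u x ^ 2 + η x ^ 2 - 2 * ε * iteratedDeriv 2 u x ^ 2 - P' x) := by
    refine intervalIntegral.integral_mono_on hL (hint (by fun_prop)) (hint (by fun_prop))
      fun x hx => ?_
    have hprod : deriv (fun y => ξ y * u y) x = deriv ξ x * u x + ξ x * iteratedDeriv 1 u x :=
      ((hξ0 x).mul (hu0 x)).deriv
    have hw : w x = η x - (γ * u x + iteratedDeriv 3 u x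
        + (deriv ξ x * u x + ξ x * iteratedDeriv 1 u x)
        + u x * iteratedDeriv 1 u x + ε * iteratedDeriv 4 u x) := by
      rw [← heq x, hprod, iteratedDeriv_one]; ring
    have hξB := mul_le_mul_of_nonneg_right (neg_le_of_abs_le (hB x hx)) (sq_nonneg (u x))
    have hγu := mul_nonneg hγ (sq_nonneg (u x))
    simp only [P', hw]
    nlinarith [sq_nonneg (u x - η x)]
  refine key.trans_eq ?_
  rw [intervalIntegral.integral_sub (hint (by fun_prop)) (hint hP'c), hP0,
    intervalIntegral.integral_sub (hint (by fun_prop)) (hint (by fun_prop)),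
    intervalIntegral.integral_add (hint (by fun_prop)) (hint (by fun_prop)),
    intervalIntegral.integral_const_mul, intervalIntegral.integral_const_mul, sub_zero]

/-- A Grönwall bound for `E + ∫ D` when `E' + D ≤ K E + b` and `D ≥ 0`. -/
theorem gronwall_add_integral_le {E E' D : ℝ → ℝ} {T K b t : ℝ}
    (hK : 0 ≤ K) (hb : 0 ≤ b) (hD : Continuous D) (hD0 : ∀ s, 0 ≤ D s)
    (hE0 : 0 ≤ E 0) (hE : ∀ s, HasDerivAt E (E' s) s)
    (hle : ∀ s, 0 ≤ s → s ≤ T → E' s ≤ K * E s + b - D s) (ht : 0 ≤ t) (htT : t ≤ T) :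
    E t + ∫ s in (0 : ℝ)..t, D s ≤ Real.exp (K * T) * (E 0 + b * T) := by
  let G : ℝ → ℝ := fun s => Real.exp (-(K * s)) * (E s + ∫ r in (0 : ℝ)..s, D r) - b * s
  have hG (s : ℝ) : HasDerivAt G (Real.exp (-(K * s)) * -K * (E s + ∫ r in (0 : ℝ)..s, D r)
      + Real.exp (-(K * s)) * (E' s + D s) - b) s := by
    have he : HasDerivAt (fun s : ℝ => Real.exp (-(K * s))) (Real.exp (-(K * s)) * -K) s := by
      simpa using ((hasDerivAt_id s).const_mul K).neg.exp
    refine ((he.fun_mul ((hE s).fun_add (hD.integral_hasStrictDerivAt 0 s).hasDerivAt)).fun_sub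
      ((hasDerivAt_id s).const_mul b)).congr_deriv ?_
    ring
  have hanti : AntitoneOn G (Set.Icc 0 T) := by
    refine antitoneOn_of_deriv_nonpos (convex_Icc 0 T)
      (fun s _ => (hG s).continuousAt.continuousWithinAt)
      (fun s _ => (hG s).differentiableAt.differentiableWithinAt) fun s hs => ?_
    rw [interior_Icc] at hs
    rw [(hG s).deriv]
    have hDs : 0 ≤ ∫ r in (0 : ℝ)..s, D r :=
      intervalIntegral.integral_nonneg hs.1.le fun r _ => hD0 r
    have hexp : Real.exp (-(K * s)) ≤ 1 :=
      Real.exp_le_one_iff.2 (neg_nonpos.2 (mul_nonneg hK hs.1.le))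
    have h1 : -K * (E s + ∫ r in (0 : ℝ)..s, D r) + (E' s + D s) ≤ b := by
      nlinarith [hle s hs.1.le hs.2.le, mul_nonneg hK hDs]
    have h2 := mul_le_mul_of_nonneg_left h1 (Real.exp_pos (-(K * s))).le
    have h3 := mul_le_mul_of_nonneg_right hexp hb
    linarith
  have hGt := hanti ⟨le_rfl, ht.trans htT⟩ ⟨ht, htT⟩ ht
  simp only [G, mul_zero, neg_zero, Real.exp_zero, intervalIntegral.integral_same, add_zero,
    one_mul, sub_zero] at hGt
  have hbt : b * t ≤ b * T := mul_le_mul_of_nonneg_left htT hb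
  have hbT : 0 ≤ b * T := mul_nonneg hb (ht.trans htT)
  calc E t + ∫ s in (0 : ℝ)..t, D s
      = Real.exp (K * t) * (Real.exp (-(K * t)) * (E t + ∫ s in (0 : ℝ)..t, D s)) := by
        rw [← mul_assoc, ← Real.exp_add]; simp
    _ ≤ Real.exp (K * t) * (E 0 + b * T) :=
        mul_le_mul_of_nonneg_left (by linarith) (Real.exp_pos _).le
    _ ≤ Real.exp (K * T) * (E 0 + b * T) :=
        mul_le_mul_of_nonneg_right
          (Real.exp_le_exp.2 (mul_le_mul_of_nonneg_left htT hK)) (by linarith)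

theorem L2norm_sq (w : ℝ → ℝ) : L2norm w ^ 2 = ∫ x in (0 : ℝ)..(2 * Real.pi), w x ^ 2 :=
  Real.sq_sqrt (intervalIntegral.integral_nonneg Real.two_pi_pos.le fun _ _ => sq_nonneg _)

theorem L2norm_nonneg (w : ℝ → ℝ) : 0 ≤ L2norm w := Real.sqrt_nonneg _

/-- uniform-in-`ε` `L²` a priori bound for the parabolic regularization. -/
theorem reg_L2_apriori (γ T μ ρ ν : ℝ)
    (hγ : 0 < γ) (hT : 0 < T) (hμ : 0 < μ) (hρ : 0 < ρ) (hν : 0 < ν) :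
    ∃ C : ℝ, 1 ≤ C ∧
      ∀ ε : ℝ, 0 < ε →
        ∀ ξ η v : ℝ → ℝ → ℝ,
          RegData T 2 ρ ξ → RegData T 0 ν η →
          IsRegSol γ ε T ξ η v → L2norm (v 0) ≤ μ →
          ∀ t : ℝ, 0 ≤ t → t ≤ T →
            L2norm (v t)
              + Real.sqrt ε * Real.sqrt (∫ s in (0:ℝ)..T, (Hnorm 2 (v s)) ^ 2) ≤ C := by
  set K : ℝ := (2 * Real.pi + ρ ^ 2) / 2 + 1 with hK
  set M : ℝ := Real.exp (K * T) * (μ ^ 2 + ν ^ 2 * T) with hM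
  have hK0 : 0 ≤ K := by positivity
  refine ⟨1 + (√M + √M), by linarith [Real.sqrt_nonneg M], ?_⟩
  intro ε hε ξ η v hξ hη hv hv0 t ht htT
  obtain ⟨hsm, hvt, heq⟩ := hv
  have hsm' : ContDiff ℝ (⊤ : ℕ∞) (Function.uncurry v) := hsm
  have hvs (s : ℝ) : ContDiff ℝ (⊤ : ℕ∞) (v s) := hsm'.comp (contDiff_prodMk_right s)
  have hvt_cont := (contDiff_deriv_fst hsm').continuous
  have hD : Continuous fun s => 2 * ε * Hnorm 2 (v s) ^ 2 := by
    simp only [Hnorm, L2norm_sq]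
    refine continuous_const.mul
      (intervalIntegral.continuous_parametric_intervalIntegral_of_continuous' ?_ _ _)
    exact (contDiff_iteratedDeriv_snd hsm' 2).continuous.pow 2
  have hE (s : ℝ) : HasDerivAt (fun s => L2norm (v s) ^ 2)
      (∫ x in (0 : ℝ)..(2 * Real.pi), 2 * v s x * deriv (fun r => v r x) s) s := by
    simp only [L2norm_sq]
    refine hasDerivAt_intervalIntegral_of_continuous
      (F' := fun s x => 2 * v s x * deriv (fun r => v r x) s) _ _ s
      (fun r => (hvs r).continuous.pow 2) ((continuous_const.mul hsm.continuous).mul hvt_cont)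
      fun r x => ?_
    have hdiff : DifferentiableAt ℝ (fun r => v r x) r :=
      (hsm'.comp (contDiff_prodMk_left x)).differentiable (by simp) r
    simpa using hdiff.hasDerivAt.fun_pow 2
  have hle (s : ℝ) (hs : 0 ≤ s) (hsT : s ≤ T) :
      ∫ x in (0 : ℝ)..(2 * Real.pi), 2 * v s x * deriv (fun r => v r x) s ≤
        K * L2norm (v s) ^ 2 + ν ^ 2 - 2 * ε * Hnorm 2 (v s) ^ 2 := by
    obtain ⟨hξs, hξp, -⟩ := hξ.2.1 s hs hsT
    have hξH : Hnorm 2 (ξ s) ^ 2 ≤ ρ ^ 2 :=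
      pow_le_pow_left₀ (L2norm_nonneg _) (hξ.2.2 s hs hsT) 2
    have hηH : Hnorm 0 (η s) ^ 2 ≤ ν ^ 2 :=
      pow_le_pow_left₀ (L2norm_nonneg _) (hη.2.2 s hs hsT) 2
    rw [Hnorm, L2norm_sq] at hξH hηH
    rw [iteratedDeriv_zero] at hηH
    have h := integral_mul_le_of_regularized (B := (2 * Real.pi + ρ ^ 2) / 2) Real.two_pi_pos.le
      hγ.le (hvs s) (hvt s hs hsT).2.1 hξs hξp (hη.2.1 s hs hsT).1.continuous
      (hvt_cont.comp (Continuous.prodMk_right s))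
      (fun x hx => (abs_deriv_le_of_periodic Real.two_pi_pos hξs hξp hx).trans (by linarith))
      (fun x => heq s x hs hsT)
    rw [Hnorm, L2norm_sq, L2norm_sq]
    exact h.trans (by rw [hK]; linarith)
  have hbound (r : ℝ) (hr : 0 ≤ r) (hrT : r ≤ T) :
      L2norm (v r) ^ 2 + ∫ s in (0 : ℝ)..r, 2 * ε * Hnorm 2 (v s) ^ 2 ≤ M := by
    have hμ0 : L2norm (v 0) ^ 2 ≤ μ ^ 2 := pow_le_pow_left₀ (L2norm_nonneg _) hv0 2
    refine (gronwall_add_integral_le (E := fun s => L2norm (v s) ^ 2) hK0 (sq_nonneg ν) hD (fun s => by positivity)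
      (sq_nonneg _) hE hle hr hrT).trans ?_
    exact mul_le_mul_of_nonneg_left (by linarith) (Real.exp_pos _).le
  have hnn (r : ℝ) (hr : 0 ≤ r) : 0 ≤ ∫ s in (0 : ℝ)..r, Hnorm 2 (v s) ^ 2 :=
    intervalIntegral.integral_nonneg hr fun s _ => sq_nonneg _
  simp only [intervalIntegral.integral_const_mul] at hbound
  have h1 : L2norm (v t) ≤ √M :=
    Real.le_sqrt_of_sq_le (by linarith [hbound t ht htT, mul_nonneg hε.le (hnn t ht)])
  have h2 : √ε * √(∫ s in (0 : ℝ)..T, Hnorm 2 (v s) ^ 2) ≤ √M := by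
    rw [← Real.sqrt_mul hε.le]
    exact Real.sqrt_le_sqrt (by
      linarith [hbound T hT.le le_rfl, mul_nonneg hε.le (hnn T hT.le), sq_nonneg (L2norm (v T))])
  linarith
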